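/- arXiv:2512.08132 — 8 statements merged into one kernel-verified Lean document; each statement's English description precedes it below -/
import Mathlib

section
/- Let X be a nonempty closed convex subset of a finite-dimensional real normed space E, let h: X → ℝ be a continuous K-strongly convex regularizer with mirror map Q, fix y ∈ E* and set x = Q(y). Then Q(y + v) = x for every v in the polar cone PC(x) = { v ∈ E* : ⟨v, w⟩ ≤ 0 for all w ∈ TC(x) }, where TC(x) is the tangent cone to X at x, i.e. the closure of { w ∈ E : x + t w ∈ X for some t > 0 }. -/
/-- Let `X` be a nonempty closed convex subset of a finite-dimensional real normed
space `E`, let `h : X → ℝ` be a continuous `K`-strongly convex regularizer with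
mirror map `Q`, fix `y ∈ E*` and set `x = Q y`.  Then `Q (y + v) = x` for every
`v` in the polar cone `PC x = {v : ⟨v, w⟩ ≤ 0 for all w ∈ TC x}`, where
`TC x = cl {w : x + t w ∈ X for some t > 0}` is the tangent cone to `X` at `x`. -/
theorem mirror_map_add_polar_cone
    {E : Type*} [NormedAddCommGroup E] [NormedSpace ℝ E] [FiniteDimensional ℝ E]
    (X : Set E) (hXne : X.Nonempty) (hXcl : IsClosed X) (hXcv : Convex ℝ X)
    (h : E → ℝ) (K : ℝ) (hK : 0 < K)
    (hcont : ContinuousOn h X)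
    (hsc : ∀ x ∈ X, ∀ x' ∈ X, ∀ t : ℝ, t ∈ Set.Icc (0:ℝ) 1 →
      h (t • x + (1 - t) • x') ≤
        t * h x + (1 - t) * h x' - K / 2 * (t * (1 - t)) * ‖x' - x‖ ^ 2)
    (Q : (E →L[ℝ] ℝ) → E)
    (hQmem : ∀ y, Q y ∈ X)
    (hQmax : ∀ y, ∀ x ∈ X, y x - h x ≤ y (Q y) - h (Q y))
    (hQuniq : ∀ y : E →L[ℝ] ℝ, ∀ x ∈ X, (∀ x' ∈ X, y x' - h x' ≤ y x - h x) → x = Q y)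
    (y : E →L[ℝ] ℝ) (x : E) (hxQ : x = Q y)
    (v : E →L[ℝ] ℝ)
    (hv : ∀ w ∈ closure {w : E | ∃ t : ℝ, 0 < t ∧ x + t • w ∈ X}, v w ≤ 0) :
    Q (y + v) = x := by
  subst hxQ
  refine (hQuniq (y + v) (Q y) (hQmem y) fun x' hx' => ?_).symm
  have hpolar : v (x' - Q y) ≤ 0 :=
    hv _ (subset_closure ⟨1, one_pos, by simpa using hx'⟩)
  rw [map_sub] at hpolar
  have hmax := hQmax y x' hx'
  simp only [add_apply]
  linarith
end

section
/- Let X be a nonempty closed convex subset of a finite-dimensional real normed space E, let h: X → ℝ be a continuous K-strongly convex regularizer, and define the convex conjugate h*(y) = max_{x∈X} {⟨y,x⟩ − h(x)} and the mirror map Q(y) = argmax_{x∈X} {⟨y,x⟩ − h(x)}. Then h*: E* → ℝ is differentiable everywhere and ∇h*(y) = Q(y) for all y ∈ E*. -/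
/-- A maximizer `q` over a convex set of a linear functional minus a strongly convex function
beats every other point by a quadratic margin. -/
theorem sub_add_sq_norm_le_of_strongly_convex_of_maximizer
    {E : Type*} [NormedAddCommGroup E] [NormedSpace ℝ E]
    {X : Set E} (hX : Convex ℝ X) {h : E → ℝ} {K : ℝ}
    (hsc : ∀ x ∈ X, ∀ x' ∈ X, ∀ t : ℝ, t ∈ Set.Icc (0:ℝ) 1 →
      h (t • x + (1 - t) • x') ≤
        t * h x + (1 - t) * h x' - K / 2 * (t * (1 - t)) * ‖x' - x‖ ^ 2)
    {y : E →L[ℝ] ℝ} {q : E} (hq : q ∈ X) (hmax : ∀ x ∈ X, y x - h x ≤ y q - h q)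
    {x : E} (hx : x ∈ X) :
    y x - h x + K / 4 * ‖x - q‖ ^ 2 ≤ y q - h q := by
  have hmid := hmax _ (hX hq hx (a := 1 / 2) (b := 1 - 1 / 2)
    (by norm_num) (by norm_num) (by norm_num))
  have hconv := hsc q hq x hx (1 / 2) ⟨by norm_num, by norm_num⟩
  simp only [map_add, map_smul, smul_eq_mul] at hmid
  linarith


/-- Let `X` be a nonempty closed convex subset of a finite-dimensional real normed
space `E`, let `h : X → ℝ` be a continuous `K`-strongly convex regularizer,
define the convex conjugate `h* y = max_{x ∈ X} {⟨y, x⟩ - h x}` and the mirror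
map `Q y = argmax_{x ∈ X} {⟨y, x⟩ - h x}`.  Then `h* : E* → ℝ` is differentiable
everywhere and `∇h* y = Q y` for all `y ∈ E*` (i.e. the Fréchet derivative of
`h*` at `y` is the evaluation functional `z ↦ ⟨z, Q y⟩` on `E*`). -/
theorem conjugate_differentiable_with_gradient_mirror_map
    {E : Type*} [NormedAddCommGroup E] [NormedSpace ℝ E] [FiniteDimensional ℝ E]
    (X : Set E) (hXne : X.Nonempty) (hXcl : IsClosed X) (hXcv : Convex ℝ X)
    (h : E → ℝ) (K : ℝ) (hK : 0 < K)
    (hcont : ContinuousOn h X)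
    (hsc : ∀ x ∈ X, ∀ x' ∈ X, ∀ t : ℝ, t ∈ Set.Icc (0:ℝ) 1 →
      h (t • x + (1 - t) • x') ≤
        t * h x + (1 - t) * h x' - K / 2 * (t * (1 - t)) * ‖x' - x‖ ^ 2)
    (Q : (E →L[ℝ] ℝ) → E)
    (hQmem : ∀ y, Q y ∈ X)
    (hQmax : ∀ y, ∀ x ∈ X, y x - h x ≤ y (Q y) - h (Q y))
    (hstar : (E →L[ℝ] ℝ) → ℝ)
    (hstar_eq : ∀ y, hstar y = y (Q y) - h (Q y)) :
    ∀ y : E →L[ℝ] ℝ,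
      HasFDerivAt hstar (NormedSpace.inclusionInDoubleDual ℝ E (Q y)) y := by
  intro y
  have hbound (y' : E →L[ℝ] ℝ) :
      ‖hstar y' - hstar y - NormedSpace.inclusionInDoubleDual ℝ E (Q y) (y' - y)‖
        ≤ 1 / K * ‖‖y' - y‖ ^ 2‖ := by
    have hgap := sub_add_sq_norm_le_of_strongly_convex_of_maximizer hXcv hsc
      (hQmem y) (hQmax y) (hQmem y')
    have hlower := hQmax y' (Q y) (hQmem y)
    have hop := (le_abs_self _).trans ((y' - y).le_opNorm (Q y' - Q y))
    have hyoung : ‖y' - y‖ * ‖Q y' - Q y‖ - K / 4 * ‖Q y' - Q y‖ ^ 2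
        ≤ 1 / K * ‖y' - y‖ ^ 2 := by
      have hsq : 1 / K * ‖y' - y‖ ^ 2
          - (‖y' - y‖ * ‖Q y' - Q y‖ - K / 4 * ‖Q y' - Q y‖ ^ 2)
          = 1 / K * (‖y' - y‖ - K / 2 * ‖Q y' - Q y‖) ^ 2 := by
        field_simp
        ring
      have hnonneg : 0 ≤ 1 / K * (‖y' - y‖ - K / 2 * ‖Q y' - Q y‖) ^ 2 := by positivity
      linarith
    simp only [map_sub, sub_apply] at hop
    rw [hstar_eq, hstar_eq, NormedSpace.dual_def, sub_apply,
      Real.norm_of_nonneg (sq_nonneg ‖y' - y‖), Real.norm_eq_abs, abs_le]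
    have hnonneg : 0 ≤ 1 / K * ‖y' - y‖ ^ 2 := by positivity
    constructor <;> linarith
  rw [hasFDerivAt_iff_isLittleO]
  exact (Asymptotics.IsBigO.of_bound (1 / K) (Filter.Eventually.of_forall hbound)).trans_isLittleO
    (Asymptotics.isLittleO_pow_sub_sub y one_lt_two)
end

section
/- Let X be a nonempty closed convex subset of a finite-dimensional real normed space E, let h: X → ℝ be a continuous K-strongly convex regularizer with conjugate h*, mirror map Q, and Fenchel coupling F(p,y) = h(p) + h*(y) − ⟨y,p⟩. Then for all p ∈ X and y ∈ E*: F(p,y) ≥ (K/2)·‖Q(y) − p‖². -/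
/-- If `(1 - t) * c ≤ a` for all `t ∈ (0, 1)`, then `c ≤ a`. -/
theorem le_of_forall_one_sub_mul_le {a c : ℝ}
    (hac : ∀ t ∈ Set.Ioo (0 : ℝ) 1, (1 - t) * c ≤ a) : c ≤ a := by
  have hcont : Continuous fun t : ℝ => (1 - t) * c := by fun_prop
  have hlim : Filter.Tendsto (fun t : ℝ => (1 - t) * c) (nhdsWithin 0 (Set.Ioi 0)) (nhds c) := by
    simpa using (hcont.tendsto 0).mono_left nhdsWithin_le_nhds
  exact le_of_tendsto hlim (Filter.eventually_of_mem (Ioo_mem_nhdsGT one_pos) hac)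

/-- Let `X` be a nonempty closed convex subset of a finite-dimensional real normed
space `E`, let `h : X → ℝ` be a continuous `K`-strongly convex regularizer with
conjugate `h*`, mirror map `Q`, and Fenchel coupling
`F p y = h p + h* y - ⟨y, p⟩`.  Then for all `p ∈ X` and `y ∈ E*`:
`F p y ≥ (K / 2) · ‖Q y - p‖²`. -/
theorem fenchel_coupling_ge_half_sq_dist
    {E : Type*} [NormedAddCommGroup E] [NormedSpace ℝ E] [FiniteDimensional ℝ E]
    (X : Set E) (hXne : X.Nonempty) (hXcl : IsClosed X) (hXcv : Convex ℝ X)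
    (h : E → ℝ) (K : ℝ) (hK : 0 < K)
    (hcont : ContinuousOn h X)
    (hsc : ∀ x ∈ X, ∀ x' ∈ X, ∀ t : ℝ, t ∈ Set.Icc (0:ℝ) 1 →
      h (t • x + (1 - t) • x') ≤
        t * h x + (1 - t) * h x' - K / 2 * (t * (1 - t)) * ‖x' - x‖ ^ 2)
    (Q : (E →L[ℝ] ℝ) → E)
    (hQmem : ∀ y, Q y ∈ X)
    (hQmax : ∀ y, ∀ x ∈ X, y x - h x ≤ y (Q y) - h (Q y))
    (hstar : (E →L[ℝ] ℝ) → ℝ)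
    (hstar_eq : ∀ y, hstar y = y (Q y) - h (Q y))
    (p : E) (hp : p ∈ X) (y : E →L[ℝ] ℝ) :
    K / 2 * ‖Q y - p‖ ^ 2 ≤ h p + hstar y - y p := by
  rw [hstar_eq]
  refine le_of_forall_one_sub_mul_le fun t ht => ?_
  have hmem : t • p + (1 - t) • Q y ∈ X :=
    hXcv hp (hQmem y) ht.1.le (sub_nonneg.2 ht.2.le) (by ring)
  have hmax := hQmax y _ hmem
  have hconv := hsc p hp (Q y) (hQmem y) t (Set.Ioo_subset_Icc_self ht)
  simp only [map_add, map_smul, smul_eq_mul] at hmax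
  refine le_of_mul_le_mul_left ?_ ht.1
  linarith
end

section
/- One-step bound for the Fenchel coupling: let X be a nonempty closed convex subset of a finite-dimensional real normed space E, let h: X → ℝ be a continuous K-strongly convex regularizer with conjugate h*, mirror map Q, and Fenchel coupling F(p,y) = h(p) + h*(y) − ⟨y,p⟩. Fix p ∈ X and y, v ∈ E*, and set x = Q(y). Then: F(p, y + v) ≤ F(p, y) + ⟨v, x − p⟩ + ‖v‖*²/(2K), where ‖·‖* denotes the dual norm on E*. -/
/-- Quadratic growth at a maximizer: if `x` maximizes `y - h` over the convex set `X` and `h` is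
`K`-strongly convex on `X`, then `y - h` drops at least quadratically away from `x`. -/
theorem strongly_convex_quadratic_growth
    {E : Type*} [NormedAddCommGroup E] [NormedSpace ℝ E]
    {X : Set E} (hXcv : Convex ℝ X) {h : E → ℝ} {K : ℝ} (hK : 0 ≤ K)
    (hsc : ∀ x ∈ X, ∀ x' ∈ X, ∀ t : ℝ, t ∈ Set.Icc (0:ℝ) 1 →
      h (t • x + (1 - t) • x') ≤
        t * h x + (1 - t) * h x' - K / 2 * (t * (1 - t)) * ‖x' - x‖ ^ 2)
    {y : E →L[ℝ] ℝ} {x z : E} (hx : x ∈ X) (hz : z ∈ X)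
    (hmax : ∀ w ∈ X, y w - h w ≤ y x - h x) :
    y z - h z + K / 2 * ‖x - z‖ ^ 2 ≤ y x - h x := by
  set D := K / 2 * ‖x - z‖ ^ 2 with hD
  have hD0 : 0 ≤ D := by positivity
  have key : ∀ t : ℝ, 0 < t → t ≤ 1 → y z - h z + (1 - t) * D ≤ y x - h x := by
    intro t ht ht1
    have h1 := hsc z hz x hx t ⟨ht.le, ht1⟩
    have h2 := hmax _ (hXcv hz hx ht.le (sub_nonneg.2 ht1) (by ring))
    simp only [map_add, map_smul, smul_eq_mul] at h2
    refine le_of_mul_le_mul_left ?_ ht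
    rw [hD]
    linarith
  by_contra! hlt
  set e := y z - h z + D - (y x - h x) with he
  have he0 : 0 < e := by linarith
  have hden : 0 < 2 * (D + e) := by linarith
  have h3 := key (e / (2 * (D + e))) (by positivity) ((div_le_one hden).2 (by linarith))
  have h4 : e / (2 * (D + e)) * D < e := by
    rw [div_mul_eq_mul_div, div_lt_iff₀ hden]
    nlinarith
  linarith


/-- **one-step bound for the Fenchel coupling.**
Let `X` be a nonempty closed convex subset of a finite-dimensional real normed
space `E`, let `h : X → ℝ` be a continuous `K`-strongly convex regularizer with
conjugate `h*`, mirror map `Q`, and Fenchel coupling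
`F p y = h p + h* y - ⟨y, p⟩`.  Fix `p ∈ X` and `y, v ∈ E*`, and set `x = Q y`.
Then: `F p (y + v) ≤ F p y + ⟨v, x - p⟩ + ‖v‖*² / (2 K)`, where `‖·‖*` is the
dual (operator) norm on `E*`. -/
theorem fenchel_coupling_one_step_bound
    {E : Type*} [NormedAddCommGroup E] [NormedSpace ℝ E] [FiniteDimensional ℝ E]
    (X : Set E) (hXne : X.Nonempty) (hXcl : IsClosed X) (hXcv : Convex ℝ X)
    (h : E → ℝ) (K : ℝ) (hK : 0 < K)
    (hcont : ContinuousOn h X)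
    (hsc : ∀ x ∈ X, ∀ x' ∈ X, ∀ t : ℝ, t ∈ Set.Icc (0:ℝ) 1 →
      h (t • x + (1 - t) • x') ≤
        t * h x + (1 - t) * h x' - K / 2 * (t * (1 - t)) * ‖x' - x‖ ^ 2)
    (Q : (E →L[ℝ] ℝ) → E)
    (hQmem : ∀ y, Q y ∈ X)
    (hQmax : ∀ y, ∀ x ∈ X, y x - h x ≤ y (Q y) - h (Q y))
    (hstar : (E →L[ℝ] ℝ) → ℝ)
    (hstar_eq : ∀ y, hstar y = y (Q y) - h (Q y))
    (p : E) (hp : p ∈ X) (y v : E →L[ℝ] ℝ)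
    (x : E) (hxQ : x = Q y) :
    h p + hstar (y + v) - (y + v) p ≤
      (h p + hstar y - y p) + v (x - p) + ‖v‖ ^ 2 / (2 * K) := by
  subst hxQ
  have hgrowth := strongly_convex_quadratic_growth hXcv hK.le hsc (hQmem y) (hQmem (y + v))
    (hQmax y)
  set z := Q (y + v) with hz
  have hv : v z - v (Q y) ≤ ‖v‖ * ‖Q y - z‖ := by
    rw [← map_sub, norm_sub_rev]
    exact (le_abs_self _).trans (v.le_opNorm _)
  have hyoung : ‖v‖ * ‖Q y - z‖ ≤ K / 2 * ‖Q y - z‖ ^ 2 + ‖v‖ ^ 2 / (2 * K) := by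
    have hsq : K / 2 * ‖Q y - z‖ ^ 2 + ‖v‖ ^ 2 / (2 * K) - ‖v‖ * ‖Q y - z‖ =
        (K * ‖Q y - z‖ - ‖v‖) ^ 2 / (2 * K) := by
      field_simp
      ring
    have : 0 ≤ (K * ‖Q y - z‖ - ‖v‖) ^ 2 / (2 * K) := by positivity
    linarith
  rw [hstar_eq, hstar_eq, ← hz]
  simp only [add_apply, map_sub]
  linarith
end

section
/- Divergence of FTRL in null-monotone games: consider the FTRL iteration Y_{n+1} = Y_n + η ĝ_n, X_n = Q(Y_n) with constant step-size η > 0 on a nonempty closed convex set X ⊆ E, where Q is the mirror map of a continuous K-strongly convex regularizer h with conjugate h*, and ĝ_n = V(X_n) + U_n is stochastic gradient feedback with respect to a filtration (F_n) satisfying E[U_n | F_n] = 0. Assume: (i) the game is null-monotone and x* ∈ X is an equilibrium such that ⟨V(x), x − x*⟩ = 0 for all x ∈ X; (ii) h* is β-strongly convex on E* for some β > 0; (iii) there is v > 0 with E[‖ĝ_n‖*² | F_n] ≥ v² for all n. Then, setting F_n = F(x*, Y_n), one has E[F_n] ≥ F_0 + (β/2) η² v² n for all n, and in particular lim_{n→∞}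 E[F_n] = ∞. -/
open MeasureTheory Filter

lemma add_le_of_forall_add_mul_one_sub_le {a b c : ℝ}
    (H : ∀ t ∈ Set.Ioo (0 : ℝ) 1, a + c * (1 - t) ≤ b) : a + c ≤ b := by
  have hlim : Tendsto (fun t : ℝ => a + c * (1 - t)) (nhdsWithin 0 (Set.Ioi 0))
      (nhds (a + c * (1 - 0))) :=
    ((by fun_prop : Continuous fun t : ℝ => a + c * (1 - t)).tendsto 0).mono_left
      nhdsWithin_le_nhds
  have hle := le_of_tendsto hlim
    (Filter.mem_of_superset (Ioo_mem_nhdsGT (zero_lt_one (α := ℝ))) H)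
  simpa using hle

section MirrorMap

variable {E : Type*} [NormedAddCommGroup E] [NormedSpace ℝ E]

/-- The objective of the mirror map grows quadratically away from its maximizer. -/
lemma mirror_map_quadratic_growth {X : Set E} (hXcv : Convex ℝ X) {h : E → ℝ} {K : ℝ}
    (hsc : ∀ x ∈ X, ∀ x' ∈ X, ∀ t : ℝ, t ∈ Set.Icc (0:ℝ) 1 →
      h (t • x + (1 - t) • x') ≤
        t * h x + (1 - t) * h x' - K / 2 * (t * (1 - t)) * ‖x' - x‖ ^ 2)
    {y : E →L[ℝ] ℝ} {p x : E} (hp : p ∈ X) (hx : x ∈ X)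
    (hmax : ∀ z ∈ X, y z - h z ≤ y p - h p) :
    y x - h x + K / 2 * ‖p - x‖ ^ 2 ≤ y p - h p := by
  refine add_le_of_forall_add_mul_one_sub_le fun t ht => ?_
  have h1 := hsc x hx p hp t ⟨ht.1.le, ht.2.le⟩
  have h2 := hmax _ (hXcv hx hp ht.1.le (sub_nonneg.2 ht.2.le) (by ring))
  simp only [map_add, map_smul, smul_eq_mul] at h2
  have h3 : t * (y x - h x + K / 2 * ‖p - x‖ ^ 2 * (1 - t)) ≤ t * (y p - h p) := by
    linarith
  exact le_of_mul_le_mul_left h3 ht.1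

/-- The mirror map of a strongly convex regularizer is continuous. -/
lemma continuous_mirror_map {X : Set E} (hXcv : Convex ℝ X) {h : E → ℝ} {K : ℝ} (hK : 0 < K)
    (hsc : ∀ x ∈ X, ∀ x' ∈ X, ∀ t : ℝ, t ∈ Set.Icc (0:ℝ) 1 →
      h (t • x + (1 - t) • x') ≤
        t * h x + (1 - t) * h x' - K / 2 * (t * (1 - t)) * ‖x' - x‖ ^ 2)
    {Q : (E →L[ℝ] ℝ) → E} (hQmem : ∀ y, Q y ∈ X)
    (hQmax : ∀ y, ∀ x ∈ X, y x - h x ≤ y (Q y) - h (Q y)) : Continuous Q := by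
  refine (LipschitzWith.of_dist_le' (K := K⁻¹) fun y y' => ?_).continuous
  rw [dist_eq_norm, dist_eq_norm, inv_mul_eq_div, le_div_iff₀ hK]
  have h1 := mirror_map_quadratic_growth hXcv hsc (hQmem y) (hQmem y') (hQmax y)
  have h2 := mirror_map_quadratic_growth hXcv hsc (hQmem y') (hQmem y) (hQmax y')
  rw [norm_sub_rev (Q y') (Q y)] at h2
  have h3 : (y - y') (Q y - Q y') ≤ ‖y - y'‖ * ‖Q y - Q y'‖ :=
    (le_abs_self _).trans ((y - y').le_opNorm _)
  simp only [sub_apply, map_sub] at h3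
  rcases (norm_nonneg (Q y - Q y')).eq_or_lt with h0 | h0
  · rw [← h0, zero_mul]
    exact norm_nonneg _
  · refine le_of_mul_le_mul_right ?_ h0
    nlinarith

/-- A strongly convex conjugate lies above its tangents by a quadratic term. -/
lemma conjugate_add_quadratic_le {X : Set E} {h : E → ℝ} {Q : (E →L[ℝ] ℝ) → E}
    (hQmem : ∀ y, Q y ∈ X) (hQmax : ∀ y, ∀ x ∈ X, y x - h x ≤ y (Q y) - h (Q y))
    {hstar : (E →L[ℝ] ℝ) → ℝ} (hstar_eq : ∀ y, hstar y = y (Q y) - h (Q y)) {β : ℝ}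
    (hstar_sc : ∀ y y' : E →L[ℝ] ℝ, ∀ t : ℝ, t ∈ Set.Icc (0:ℝ) 1 →
      hstar (t • y + (1 - t) • y') ≤
        t * hstar y + (1 - t) * hstar y' - β / 2 * (t * (1 - t)) * ‖y' - y‖ ^ 2)
    (y w : E →L[ℝ] ℝ) :
    hstar y + w (Q y) + β / 2 * ‖w‖ ^ 2 ≤ hstar (y + w) := by
  refine add_le_of_forall_add_mul_one_sub_le fun t ht => ?_
  have h1 := hstar_sc (y + w) y t ⟨ht.1.le, ht.2.le⟩
  have h2 := hQmax (t • (y + w) + (1 - t) • y) (Q y) (hQmem y)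
  rw [← hstar_eq] at h2
  rw [sub_add_cancel_left, norm_neg] at h1
  simp only [add_apply, smul_apply, smul_eq_mul] at h2
  have h4 := hstar_eq y
  have h3 : t * (hstar y + w (Q y) + β / 2 * ‖w‖ ^ 2 * (1 - t)) ≤ t * hstar (y + w) := by
    linear_combination h1 + h2 + h4
  exact le_of_mul_le_mul_left h3 ht.1

end MirrorMap

/-- Pairing a conditionally centred functional with a predictable vector has mean zero. -/
lemma integral_apply_eq_zero_of_condExp_eq_zero {E Ω : Type*} [NormedAddCommGroup E]
    [NormedSpace ℝ E] {m mΩ : MeasurableSpace Ω} {μ : Measure Ω}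
    [IsFiniteMeasure μ] (hm : m ≤ mΩ) {U : Ω → E →L[ℝ] ℝ} {W : Ω → E}
    (hW : StronglyMeasurable[m] W) (hU : Integrable U μ) (hUm : μ[U | m] =ᵐ[μ] 0)
    (hUW : Integrable (fun ω => U ω (W ω)) μ) : ∫ ω, U ω (W ω) ∂μ = 0 := by
  have hpull := condExp_bilin_of_stronglyMeasurable_right
    (ContinuousLinearMap.id ℝ (E →L[ℝ] ℝ)) hW hUW hU
  rw [← integral_condExp hm]
  refine integral_eq_zero_of_ae ?_
  filter_upwards [hpull, hUm] with ω h1 h2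
  simpa [h2] using h1

/-- **divergence of FTRL in null-monotone games.**
Consider the FTRL iteration `Y (n+1) = Y n + η ĝ n`, `X n = Q (Y n)` with
constant step-size `η > 0` on a nonempty closed convex set `X ⊆ E`, where `Q`
is the mirror map of a continuous `K`-strongly convex regularizer `h` with
conjugate `h*`, and `ĝ n = V (X n) + U n` is stochastic gradient feedback with
respect to a filtration `ℱ` satisfying `E[U n | ℱ n] = 0`.  Assume:
(i) the game is null-monotone and `x* ∈ X` is an equilibrium such that
`⟨V x, x - x*⟩ = 0` for all `x ∈ X`;
(ii) `h*` is `β`-strongly convex on `E*` for some `β > 0`;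
(iii) there is `v > 0` with `E[‖ĝ n‖*² | ℱ n] ≥ v²` for all `n`.
Then, writing `Fen n = F (x*, Y n)` for the Fenchel coupling, one has
`E[Fen n] ≥ Fen 0 + (β/2) η² v² n` for all `n`; in particular
`lim_{n → ∞} E[Fen n] = ∞`. -/
theorem ftrl_diverges_in_null_monotone_games
    {E : Type*} [NormedAddCommGroup E] [NormedSpace ℝ E] [FiniteDimensional ℝ E]
    (X : Set E) (hXne : X.Nonempty) (hXcl : IsClosed X) (hXcv : Convex ℝ X)
    -- the regularizer and its mirror map / conjugate / Fenchel coupling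
    (h : E → ℝ) (K : ℝ) (hK : 0 < K)
    (hcont : ContinuousOn h X)
    (hsc : ∀ x ∈ X, ∀ x' ∈ X, ∀ t : ℝ, t ∈ Set.Icc (0:ℝ) 1 →
      h (t • x + (1 - t) • x') ≤
        t * h x + (1 - t) * h x' - K / 2 * (t * (1 - t)) * ‖x' - x‖ ^ 2)
    (Q : (E →L[ℝ] ℝ) → E)
    (hQmem : ∀ y, Q y ∈ X)
    (hQmax : ∀ y, ∀ x ∈ X, y x - h x ≤ y (Q y) - h (Q y))
    (hstar : (E →L[ℝ] ℝ) → ℝ)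
    (hstar_eq : ∀ y, hstar y = y (Q y) - h (Q y))
    -- (ii) strong convexity of the conjugate on the dual space
    (β : ℝ) (hβ : 0 < β)
    (hstar_sc : ∀ y y' : E →L[ℝ] ℝ, ∀ t : ℝ, t ∈ Set.Icc (0:ℝ) 1 →
      hstar (t • y + (1 - t) • y') ≤
        t * hstar y + (1 - t) * hstar y' - β / 2 * (t * (1 - t)) * ‖y' - y‖ ^ 2)
    -- (i) the null-monotone game and its equilibrium
    (V : E → (E →L[ℝ] ℝ)) (hVcont : Continuous V)
    (hnull : ∀ x ∈ X, ∀ x' ∈ X, (V x' - V x) (x' - x) = 0)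
    (xstar : E) (hxstar : xstar ∈ X)
    (heq : ∀ x ∈ X, (V x) (x - xstar) = 0)
    -- the stochastic process
    {Ω : Type*} {mΩ : MeasurableSpace Ω} {μ : Measure Ω} [IsProbabilityMeasure μ]
    (ℱ : Filtration ℕ mΩ)
    (η : ℝ) (hη : 0 < η)
    (y₀ : E →L[ℝ] ℝ)
    (Y U : ℕ → Ω → (E →L[ℝ] ℝ))
    (hY0 : ∀ ω, Y 0 ω = y₀)
    (hrec : ∀ n ω, Y (n + 1) ω = Y n ω + η • (V (Q (Y n ω)) + U n ω))
    (hYad : ∀ n, StronglyMeasurable[ℱ n] (Y n))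
    (hUad : ∀ n, StronglyMeasurable[ℱ (n + 1)] (U n))
    (hUint : ∀ n, Integrable (U n) μ)
    (hUmean : ∀ n, μ[U n | ℱ n] =ᵐ[μ] 0)
    -- (iii) conditional lower bound on the second moment of the feedback
    (hg2int : ∀ n, Integrable (fun ω => ‖V (Q (Y n ω)) + U n ω‖ ^ 2) μ)
    (v : ℝ) (hv : 0 < v)
    (hg2lb : ∀ n, (fun _ : Ω => v ^ 2) ≤ᵐ[μ]
      μ[fun ω => ‖V (Q (Y n ω)) + U n ω‖ ^ 2 | ℱ n])
    -- integrability of the quantities appearing in the conclusion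
    (hFint : ∀ n, Integrable (fun ω => h xstar + hstar (Y n ω) - (Y n ω) xstar) μ)
    (hXUint : ∀ n, Integrable (fun ω => (U n ω) (Q (Y n ω) - xstar)) μ) :
    (∀ n : ℕ,
      (h xstar + hstar y₀ - y₀ xstar) + β / 2 * η ^ 2 * v ^ 2 * n ≤
        ∫ ω, (h xstar + hstar (Y n ω) - (Y n ω) xstar) ∂μ) ∧
    Tendsto (fun n : ℕ => ∫ ω, (h xstar + hstar (Y n ω) - (Y n ω) xstar) ∂μ)
      atTop atTop := by
  have hstep : ∀ n,
      (∫ ω, (h xstar + hstar (Y n ω) - (Y n ω) xstar) ∂μ) + β / 2 * η ^ 2 * v ^ 2 ≤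
        ∫ ω, (h xstar + hstar (Y (n + 1) ω) - (Y (n + 1) ω) xstar) ∂μ := by
    intro n
    have hQ := continuous_mirror_map hXcv hK hsc hQmem hQmax
    have hnoise : ∫ ω, (U n ω) (Q (Y n ω) - xstar) ∂μ = 0 :=
      integral_apply_eq_zero_of_condExp_eq_zero (ℱ.le n)
        ((hQ.sub continuous_const).comp_stronglyMeasurable (hYad n))
        (hUint n) (hUmean n) (hXUint n)
    have hsq : v ^ 2 ≤ ∫ ω, ‖V (Q (Y n ω)) + U n ω‖ ^ 2 ∂μ := by
      have hle := integral_mono_ae (integrable_const (v ^ 2)) integrable_condExp (hg2lb n)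
      rw [integral_condExp (ℱ.le n)] at hle
      simpa using hle
    have hmono := integral_mono
      (((hFint n).add ((hXUint n).const_mul η)).add ((hg2int n).const_mul (β / 2 * η ^ 2)))
      (hFint (n + 1)) fun ω => by
        have h1 := conjugate_add_quadratic_le hQmem hQmax hstar_eq hstar_sc (Y n ω)
          (η • (V (Q (Y n ω)) + U n ω))
        have h2 := heq _ (hQmem (Y n ω))
        rw [← hrec, norm_smul, mul_pow, Real.norm_eq_abs, sq_abs] at h1
        have h3 := congrArg (fun f : E →L[ℝ] ℝ => f xstar) (hrec n ω)
        simp only [add_apply, smul_apply, smul_eq_mul,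
          map_sub, Pi.add_apply] at h1 h2 h3 ⊢
        linear_combination h1 + h3 - η * h2
    rw [integral_add' ((hFint n).add ((hXUint n).const_mul η))
        ((hg2int n).const_mul (β / 2 * η ^ 2)),
      integral_add' (hFint n) ((hXUint n).const_mul η), integral_const_mul, integral_const_mul,
      hnoise, mul_zero, add_zero] at hmono
    have hβη : 0 ≤ β / 2 * η ^ 2 := by positivity
    linarith [mul_le_mul_of_nonneg_left hsq hβη]
  have hbound : ∀ n : ℕ,
      (h xstar + hstar y₀ - y₀ xstar) + β / 2 * η ^ 2 * v ^ 2 * n ≤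
        ∫ ω, (h xstar + hstar (Y n ω) - (Y n ω) xstar) ∂μ := by
    intro n
    induction n with
    | zero => simp [hY0]
    | succ k ih =>
      push_cast
      linarith [hstep k]
  have hrate : 0 < β / 2 * η ^ 2 * v ^ 2 := by positivity
  exact ⟨hbound, tendsto_atTop_mono hbound <|
    tendsto_atTop_add_const_left _ _ (tendsto_natCast_atTop_atTop.const_mul_atTop hrate)⟩
end

section
/- Hitting time of FTRL in strongly monotone games (initialization outside the target ball): consider the FTRL iteration Y_{n+1} = Y_n + η ĝ_n, X_n = Q(Y_n) with constant step-size η > 0 on a nonempty closed convex set X ⊆ E, where ĝ_n = V(X_n) + U_n with E[U_n | F_n] = 0 and E[‖U_n‖*² | F_n] ≤ σ². Assume the game is γ-strongly monotone with γ > 0, that ‖V(x)‖* ≤ L for all x ∈ X, that x* ∈ X is the equilibrium (so ⟨V(x*), x − x*⟩ ≤ 0 for all x ∈ X), and that h is K-strongly convex. Set r_σ² = η(σ² + L²)/(γK) and let τ_r = inf{ n ≥ 0 : ‖X_n − x*‖ ≤ r }. If r > r_σ and ‖X_0 − x*‖ > r, then E[τ_r] ≤ F(x*, Y_0) / (γ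 η (r² − r_σ²)). -/
open MeasureTheory Filter
open scoped ENNReal

section MirrorMap

variable {E : Type*} [NormedAddCommGroup E] [NormedSpace ℝ E] {X : Set E} {h : E → ℝ} {K : ℝ}
  {Q : (E →L[ℝ] ℝ) → E}

/-- The maximizer of `y - h` satisfies a quadratic growth condition when `h` is strongly convex. -/
lemma mirror_quadratic_growth (hXcv : Convex ℝ X)
    (hsc : ∀ x ∈ X, ∀ x' ∈ X, ∀ t : ℝ, t ∈ Set.Icc (0:ℝ) 1 →
      h (t • x + (1 - t) • x') ≤
        t * h x + (1 - t) * h x' - K / 2 * (t * (1 - t)) * ‖x' - x‖ ^ 2)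
    (hQmem : ∀ y, Q y ∈ X)
    (hQmax : ∀ y, ∀ x ∈ X, y x - h x ≤ y (Q y) - h (Q y))
    (y : E →L[ℝ] ℝ) {x : E} (hx : x ∈ X) :
    y x - h x + K / 2 * ‖Q y - x‖ ^ 2 ≤ y (Q y) - h (Q y) := by
  have key : ∀ t ∈ Set.Ioo (0:ℝ) 1,
      y x - h x + K / 2 * (1 - t) * ‖Q y - x‖ ^ 2 ≤ y (Q y) - h (Q y) := by
    intro t ht
    have h1 := hsc x hx (Q y) (hQmem y) t ⟨ht.1.le, ht.2.le⟩
    have h2 := hQmax y (t • x + (1 - t) • Q y)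
      (hXcv hx (hQmem y) ht.1.le (by linarith [ht.2]) (by ring))
    simp only [map_add, map_smul, smul_eq_mul] at h2
    refine le_of_mul_le_mul_left ?_ ht.1
    linarith
  have hlim : Tendsto (fun t : ℝ => y x - h x + K / 2 * (1 - t) * ‖Q y - x‖ ^ 2)
      (nhdsWithin 0 (Set.Ioi 0)) (nhds (y x - h x + K / 2 * (1 - 0) * ‖Q y - x‖ ^ 2)) :=
    (Continuous.tendsto (by fun_prop) 0).mono_left nhdsWithin_le_nhds
  have := le_of_tendsto hlim
    (Filter.eventually_of_mem (Ioo_mem_nhdsGT zero_lt_one) key)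
  simpa using this

/-- The mirror map of a `K`-strongly convex regularizer is `1/K`-Lipschitz. -/
lemma mirror_dist_le
    (hgrowth : ∀ y, ∀ x ∈ X, y x - h x + K / 2 * ‖Q y - x‖ ^ 2 ≤ y (Q y) - h (Q y))
    (hQmem : ∀ y, Q y ∈ X) (y y' : E →L[ℝ] ℝ) :
    K * ‖Q y' - Q y‖ ≤ ‖y' - y‖ := by
  have h1 := hgrowth y (Q y') (hQmem y')
  have h2 := hgrowth y' (Q y) (hQmem y)
  rw [norm_sub_rev] at h1
  have h3 : (y' - y) (Q y' - Q y) ≤ ‖y' - y‖ * ‖Q y' - Q y‖ :=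
    (le_abs_self _).trans ((y' - y).le_opNorm _)
  simp only [sub_apply, map_sub] at h3
  rcases (norm_nonneg (Q y' - Q y)).eq_or_lt with h0 | h0
  · rw [← h0]; simp
  · refine le_of_mul_le_mul_right ?_ h0
    nlinarith

lemma mirror_continuous (hK : 0 < K)
    (hgrowth : ∀ y, ∀ x ∈ X, y x - h x + K / 2 * ‖Q y - x‖ ^ 2 ≤ y (Q y) - h (Q y))
    (hQmem : ∀ y, Q y ∈ X) : Continuous Q := by
  refine (LipschitzWith.of_dist_le_mul (K := (K⁻¹).toNNReal) fun y' y => ?_).continuous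
  have := mirror_dist_le hgrowth hQmem y y'
  rw [Real.coe_toNNReal _ (inv_nonneg.2 hK.le), dist_eq_norm, dist_eq_norm,
    inv_mul_eq_div, le_div_iff₀ hK]
  linarith

/-- Smoothness of the conjugate of a strongly convex function. -/
lemma mirror_conjugate_le (hK : 0 < K)
    (hgrowth : ∀ y, ∀ x ∈ X, y x - h x + K / 2 * ‖Q y - x‖ ^ 2 ≤ y (Q y) - h (Q y))
    (hQmem : ∀ y, Q y ∈ X) (y d : E →L[ℝ] ℝ) :
    (y + d) (Q (y + d)) - h (Q (y + d)) ≤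
      y (Q y) - h (Q y) + d (Q y) + ‖d‖ ^ 2 / (2 * K) := by
  have h1 := hgrowth y (Q (y + d)) (hQmem _)
  rw [norm_sub_rev] at h1
  have h3 : d (Q (y + d) - Q y) ≤ ‖d‖ * ‖Q (y + d) - Q y‖ :=
    (le_abs_self _).trans (d.le_opNorm _)
  simp only [add_apply, map_sub] at h3 ⊢
  have h4 : ‖d‖ * ‖Q (y + d) - Q y‖ ≤
      ‖d‖ ^ 2 / (2 * K) + K / 2 * ‖Q (y + d) - Q y‖ ^ 2 := by
    have h5 : ‖d‖ ^ 2 / (2 * K) + K / 2 * ‖Q (y + d) - Q y‖ ^ 2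
        - ‖d‖ * ‖Q (y + d) - Q y‖ = (‖d‖ - K * ‖Q (y + d) - Q y‖) ^ 2 / (2 * K) := by
      field_simp
      ring
    have : 0 ≤ (‖d‖ - K * ‖Q (y + d) - Q y‖) ^ 2 / (2 * K) := by positivity
    linarith
  linarith

end MirrorMap

/-- The hitting time of `p` is at most the number of times preceding it. -/
lemma iInf_cast_le_tsum_indicator {Ω : Type*} (p : ℕ → Ω → Prop) (ω : Ω) :
    (⨅ (n : ℕ) (_ : p n ω), (n : ℝ≥0∞)) ≤
      ∑' n, {ω | ∀ k ≤ n, ¬ p k ω}.indicator (fun _ => (1 : ℝ≥0∞)) ω := by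
  classical
  by_cases hp : ∃ n, p n ω
  · refine (iInf₂_le (Nat.find hp) (Nat.find_spec hp)).trans ?_
    refine le_trans (le_of_eq ?_) (ENNReal.sum_le_tsum (Finset.range (Nat.find hp)))
    rw [Finset.sum_congr rfl fun n hn => Set.indicator_of_mem
      (show ω ∈ {ω | ∀ k ≤ n, ¬ p k ω} from fun k hk =>
        Nat.find_min hp (hk.trans_lt (Finset.mem_range.1 hn))) _]
    simp
  · push Not at hp
    have : ∀ n, {ω | ∀ k ≤ n, ¬ p k ω}.indicator (fun _ => (1 : ℝ≥0∞)) ω = 1 := fun n =>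
      Set.indicator_of_mem (show ω ∈ {ω | ∀ k ≤ n, ¬ p k ω} from fun k _ => hp k) _
    simp_rw [this, ENNReal.tsum_const_eq_top_of_ne_zero one_ne_zero]
    exact le_top

/-- A nonnegative process which decreases on average by `c` on a decreasing sequence of events
bounds the sum of the probabilities of these events. -/
lemma tsum_measure_le_of_drift {Ω : Type*} {mΩ : MeasurableSpace Ω} {μ : Measure Ω}
    [IsFiniteMeasure μ] {F : ℕ → Ω → ℝ} {A : ℕ → Set Ω} {c : ℝ} (hc : 0 < c)
    (hF : ∀ n ω, 0 ≤ F n ω) (hint : ∀ n, Integrable (F n) μ) (hA : Antitone A)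
    (hdrift : ∀ n, ∫ ω in A n, F (n + 1) ω ∂μ ≤ ∫ ω in A n, F n ω ∂μ - c * μ.real (A n)) :
    ∑' n, μ (A n) ≤ ENNReal.ofReal ((∫ ω, F 0 ω ∂μ) / c) := by
  have hsum : ∀ n, c * ∑ k ∈ Finset.range n, μ.real (A k) + ∫ ω in A n, F n ω ∂μ
      ≤ ∫ ω, F 0 ω ∂μ := by
    intro n
    induction n with
    | zero =>
      simpa using setIntegral_le_integral (hint 0) (ae_of_all _ (hF 0))
    | succ n ih =>
      have h1 : ∫ ω in A (n + 1), F (n + 1) ω ∂μ ≤ ∫ ω in A n, F (n + 1) ω ∂μ :=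
        setIntegral_mono_set (hint _).integrableOn (ae_of_all _ (hF _))
          (hA n.le_succ).eventuallyLE
      have h2 := hdrift n
      rw [Finset.sum_range_succ, mul_add]
      linarith
  refine ENNReal.tsum_le_of_sum_range_le fun n => ?_
  have h1 : ∑ k ∈ Finset.range n, μ (A k)
      = ENNReal.ofReal (∑ k ∈ Finset.range n, μ.real (A k)) := by
    rw [ENNReal.ofReal_sum_of_nonneg fun _ _ => measureReal_nonneg]
    exact Finset.sum_congr rfl fun k _ => (ofReal_measureReal).symm
  rw [h1]
  refine ENNReal.ofReal_le_ofReal ?_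
  rw [le_div_iff₀ hc]
  have h2 : 0 ≤ ∫ ω in A n, F n ω ∂μ := integral_nonneg (hF n)
  linarith [hsum n]

/-- A conditionally centered noise, paired with an adapted process, integrates to zero on every
event of the past. -/
lemma setIntegral_apply_eq_zero_of_condExp_eq_zero {E Ω : Type*} [NormedAddCommGroup E]
    [NormedSpace ℝ E] {m mΩ : MeasurableSpace Ω} (hm : m ≤ mΩ) {μ : Measure Ω}
    [IsFiniteMeasure μ] {U : Ω → (E →L[ℝ] ℝ)} {Z : Ω → E} {s : Set Ω}
    (hU : Integrable U μ) (hZ : StronglyMeasurable[m] Z)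
    (hUZ : Integrable (fun ω => U ω (Z ω)) μ) (hU0 : μ[U | m] =ᵐ[μ] 0)
    (hs : MeasurableSet[m] s) : ∫ ω in s, U ω (Z ω) ∂μ = 0 := by
  have h1 := condExp_bilin_of_stronglyMeasurable_right (μ := μ) (m := m)
    (ContinuousLinearMap.id ℝ (E →L[ℝ] ℝ)) hZ hUZ hU
  simp only [ContinuousLinearMap.id_apply] at h1
  rw [← setIntegral_condExp hm hUZ hs]
  refine integral_eq_zero_of_ae (ae_restrict_of_ae ?_)
  filter_upwards [h1, hU0] with ω h1 h0
  rw [h1, h0]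
  simp

/-- **hitting time of FTRL in strongly monotone games,
initialization outside the target ball.**
Consider the FTRL iteration `Y (n+1) = Y n + η ĝ n`, `X n = Q (Y n)` with
constant step-size `η > 0` on a nonempty closed convex set `X ⊆ E`, with
`ĝ n = V (X n) + U n`, `E[U n | ℱ n] = 0` and `E[‖U n‖*² | ℱ n] ≤ σ²`.  Assume
the game is `γ`-strongly monotone (`γ > 0`), `‖V x‖* ≤ L` on `X`, `x* ∈ X` is
the equilibrium (so `⟨V x*, x - x*⟩ ≤ 0` on `X`), and `h` is `K`-strongly
convex.  Set `r_σ² = η (σ² + L²) / (γ K)` and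
`τ_r = inf {n : ‖X n - x*‖ ≤ r}` (equal to `∞` if the ball is never hit).
If `r > r_σ` and `‖X 0 - x*‖ > r`, then
`E[τ_r] ≤ F (x*, Y 0) / (γ η (r² - r_σ²))`. -/
theorem ftrl_hitting_time_strongly_monotone_outside
    {E : Type*} [NormedAddCommGroup E] [NormedSpace ℝ E] [FiniteDimensional ℝ E]
    (X : Set E) (hXne : X.Nonempty) (hXcl : IsClosed X) (hXcv : Convex ℝ X)
    -- the regularizer and its mirror map / conjugate / Fenchel coupling
    (h : E → ℝ) (K : ℝ) (hK : 0 < K)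
    (hcont : ContinuousOn h X)
    (hsc : ∀ x ∈ X, ∀ x' ∈ X, ∀ t : ℝ, t ∈ Set.Icc (0:ℝ) 1 →
      h (t • x + (1 - t) • x') ≤
        t * h x + (1 - t) * h x' - K / 2 * (t * (1 - t)) * ‖x' - x‖ ^ 2)
    (Q : (E →L[ℝ] ℝ) → E)
    (hQmem : ∀ y, Q y ∈ X)
    (hQmax : ∀ y, ∀ x ∈ X, y x - h x ≤ y (Q y) - h (Q y))
    (hstar : (E →L[ℝ] ℝ) → ℝ)
    (hstar_eq : ∀ y, hstar y = y (Q y) - h (Q y))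
    -- the strongly monotone game and its equilibrium
    (V : E → (E →L[ℝ] ℝ)) (hVcont : Continuous V)
    (γ : ℝ) (hγ : 0 < γ)
    (hmono : ∀ x ∈ X, ∀ x' ∈ X, (V x' - V x) (x' - x) ≤ -γ * ‖x' - x‖ ^ 2)
    (L : ℝ) (hL : ∀ x ∈ X, ‖V x‖ ≤ L)
    (xstar : E) (hxstar : xstar ∈ X)
    (heq : ∀ x ∈ X, (V xstar) (x - xstar) ≤ 0)
    -- the stochastic process
    {Ω : Type*} {mΩ : MeasurableSpace Ω} {μ : Measure Ω} [IsProbabilityMeasure μ]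
    (ℱ : Filtration ℕ mΩ)
    (η : ℝ) (hη : 0 < η)
    (y₀ : E →L[ℝ] ℝ)
    (Y U : ℕ → Ω → (E →L[ℝ] ℝ))
    (hY0 : ∀ ω, Y 0 ω = y₀)
    (hrec : ∀ n ω, Y (n + 1) ω = Y n ω + η • (V (Q (Y n ω)) + U n ω))
    (hYad : ∀ n, StronglyMeasurable[ℱ n] (Y n))
    (hUad : ∀ n, StronglyMeasurable[ℱ (n + 1)] (U n))
    (hUint : ∀ n, Integrable (U n) μ)
    (hU2int : ∀ n, Integrable (fun ω => ‖U n ω‖ ^ 2) μ)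
    (hUmean : ∀ n, μ[U n | ℱ n] =ᵐ[μ] 0)
    (σ : ℝ)
    (hUvar : ∀ n, μ[fun ω => ‖U n ω‖ ^ 2 | ℱ n] ≤ᵐ[μ] fun _ : Ω => σ ^ 2)
    -- the target radius and the initialization
    (r : ℝ) (hr : Real.sqrt (η * (σ ^ 2 + L ^ 2) / (γ * K)) < r)
    (hinit : r < ‖Q y₀ - xstar‖) :
    ∫⁻ ω, (⨅ (n : ℕ) (_ : ‖Q (Y n ω) - xstar‖ ≤ r), (n : ℝ≥0∞)) ∂μ ≤
      ENNReal.ofReal ((h xstar + hstar y₀ - y₀ xstar) /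
        (γ * η * (r ^ 2 - η * (σ ^ 2 + L ^ 2) / (γ * K)))) := by
  have hgrowth : ∀ y, ∀ x ∈ X, y x - h x + K / 2 * ‖Q y - x‖ ^ 2 ≤ y (Q y) - h (Q y) :=
    fun y _ hx => mirror_quadratic_growth hXcv hsc hQmem hQmax y hx
  have hQc : Continuous Q := mirror_continuous hK hgrowth hQmem
  set ρ : ℝ := η * (σ ^ 2 + L ^ 2) / (γ * K) with hρ
  have hr0 : 0 < r := (Real.sqrt_nonneg _).trans_lt hr
  have hρr : ρ < r ^ 2 := (Real.sqrt_lt' hr0).1 hr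
  have hc : 0 < γ * η * (r ^ 2 - ρ) := by
    have := sub_pos.2 hρr
    positivity
  let Φ : (E →L[ℝ] ℝ) → ℝ := fun y => h xstar + (y (Q y) - h (Q y)) - y xstar
  let Z : ℕ → Ω → E := fun n ω => Q (Y n ω) - xstar
  have hΦc : Continuous Φ := by
    have h1 : Continuous fun y => h (Q y) := hcont.comp_continuous hQc hQmem
    have h2 : Continuous fun y : E →L[ℝ] ℝ => y (Q y) := continuous_id.clm_apply hQc
    have h3 : Continuous fun y : E →L[ℝ] ℝ => y xstar :=
      continuous_id.clm_apply continuous_const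
    exact (continuous_const.add (h2.sub h1)).sub h3
  have hΦZ : ∀ n ω, K / 2 * ‖Z n ω‖ ^ 2 ≤ Φ (Y n ω) := by
    intro n ω
    have := hgrowth (Y n ω) xstar hxstar
    simp only [Φ, Z]
    linarith
  have hΦ0 : ∀ n ω, 0 ≤ Φ (Y n ω) := fun n ω => le_trans (by positivity) (hΦZ n ω)
  have hZad : ∀ n, StronglyMeasurable[ℱ n] (Z n) := fun n =>
    (hQc.comp_stronglyMeasurable (hYad n)).sub stronglyMeasurable_const
  have hΦm : ∀ n, AEStronglyMeasurable (fun ω => Φ (Y n ω)) μ := fun n =>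
    (hΦc.comp_stronglyMeasurable ((hYad n).mono (ℱ.le n))).aestronglyMeasurable
  have hstep : ∀ n ω, Φ (Y (n + 1) ω) ≤ Φ (Y n ω) - η * γ * ‖Z n ω‖ ^ 2
      + η * U n ω (Z n ω) + η ^ 2 / K * (L ^ 2 + ‖U n ω‖ ^ 2) := by
    intro n ω
    have hx := hQmem (Y n ω)
    have h1 := mirror_conjugate_le hK hgrowth hQmem (Y n ω) (η • (V (Q (Y n ω)) + U n ω))
    rw [← hrec n ω] at h1
    have h2 := hmono xstar hxstar _ hx
    have h3 := heq _ hx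
    have h4 : ‖V (Q (Y n ω)) + U n ω‖ ^ 2 ≤ 2 * (L ^ 2 + ‖U n ω‖ ^ 2) := by
      have h5 : ‖V (Q (Y n ω)) + U n ω‖ ≤ L + ‖U n ω‖ :=
        (norm_add_le _ _).trans (add_le_add_left (hL _ hx) _)
      have h6 := pow_le_pow_left₀ (norm_nonneg _) h5 2
      nlinarith [sq_nonneg (L - ‖U n ω‖)]
    have h7 : ‖η • (V (Q (Y n ω)) + U n ω)‖ ^ 2 / (2 * K)
        ≤ η ^ 2 / K * (L ^ 2 + ‖U n ω‖ ^ 2) := by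
      rw [norm_smul, mul_pow, Real.norm_eq_abs, sq_abs, div_mul_eq_mul_div,
        div_le_div_iff₀ (by positivity) hK]
      have : 0 ≤ η ^ 2 * K := by positivity
      nlinarith [mul_le_mul_of_nonneg_left h4 this]
    have h8 : V (Q (Y n ω)) (Z n ω) ≤ -γ * ‖Z n ω‖ ^ 2 := by
      simp only [sub_apply] at h2
      linarith
    have h9 := mul_le_mul_of_nonneg_left h8 hη.le
    have h10 : Y (n + 1) ω xstar
        = Y n ω xstar + η * (V (Q (Y n ω)) xstar + U n ω xstar) := by
      simp [hrec, mul_add]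
    simp only [Φ, Z, h10, map_sub, smul_apply,
      add_apply, smul_eq_mul] at h1 h9 ⊢
    linarith
  have hZ2 : ∀ n, Integrable (fun ω => Φ (Y n ω)) μ →
      Integrable (fun ω => ‖Z n ω‖ ^ 2) μ := by
    intro n hn
    refine (hn.const_mul (2 / K)).mono'
      (((hZad n).mono (ℱ.le n)).aestronglyMeasurable.norm.pow 2) (ae_of_all _ fun ω => ?_)
    rw [Real.norm_of_nonneg (by positivity), div_mul_eq_mul_div, le_div_iff₀ hK]
    linarith [hΦZ n ω]
  have hUZ : ∀ n, Integrable (fun ω => Φ (Y n ω)) μ →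
      Integrable (fun ω => U n ω (Z n ω)) μ := by
    intro n hn
    refine ((hU2int n).add (hZ2 n hn)).mono' ?_ (ae_of_all _ fun ω => ?_)
    · exact (ContinuousLinearMap.id ℝ (E →L[ℝ] ℝ)).aestronglyMeasurable_comp₂
        (hUint n).aestronglyMeasurable ((hZad n).mono (ℱ.le n)).aestronglyMeasurable
    · refine ((U n ω).le_opNorm _).trans ?_
      simp only [Pi.add_apply]
      nlinarith [sq_nonneg (‖U n ω‖ - ‖Z n ω‖), sq_nonneg ‖U n ω‖, sq_nonneg ‖Z n ω‖]
  have hbound : ∀ n, Integrable (fun ω => Φ (Y n ω)) μ →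
      Integrable (fun ω => Φ (Y n ω) - η * γ * ‖Z n ω‖ ^ 2
        + η * U n ω (Z n ω) + η ^ 2 / K * (L ^ 2 + ‖U n ω‖ ^ 2)) μ := fun n hn =>
    ((hn.sub ((hZ2 n hn).const_mul _)).add ((hUZ n hn).const_mul _)).add
      (((integrable_const _).add (hU2int n)).const_mul _)
  have hΦint : ∀ n, Integrable (fun ω => Φ (Y n ω)) μ := by
    intro n
    induction n with
    | zero => simp [hY0]
    | succ n ih =>
      refine (hbound n ih).mono' (hΦm (n + 1)) (ae_of_all _ fun ω => ?_)
      rw [Real.norm_of_nonneg (hΦ0 _ _)]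
      exact hstep n ω
  let A : ℕ → Set Ω := fun n => {ω | ∀ k ≤ n, ¬ ‖Q (Y k ω) - xstar‖ ≤ r}
  have hAm : ∀ n, MeasurableSet[ℱ n] (A n) := by
    intro n
    have : A n = ⋂ k, ⋂ (_ : k ≤ n), {ω | ‖Z k ω‖ ≤ r}ᶜ := by
      ext ω; simp [A, Z]
    rw [this]
    refine MeasurableSet.iInter fun k => MeasurableSet.iInter fun hk => ?_
    exact (((hZad k).mono (ℱ.mono hk)).norm.measurableSet_le
      stronglyMeasurable_const).compl
  have hAanti : Antitone A := fun m n hmn ω hω k hk => hω k (hk.trans hmn)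
  have hdrift : ∀ n, ∫ ω in A n, Φ (Y (n + 1) ω) ∂μ ≤
      ∫ ω in A n, Φ (Y n ω) ∂μ - γ * η * (r ^ 2 - ρ) * μ.real (A n) := by
    intro n
    have hA := ℱ.le n _ (hAm n)
    have hU2 : ∫ ω in A n, ‖U n ω‖ ^ 2 ∂μ ≤ σ ^ 2 * μ.real (A n) := by
      rw [← setIntegral_condExp (ℱ.le n) (hU2int n) (hAm n)]
      refine (setIntegral_mono_ae integrable_condExp.integrableOn
        (integrable_const _).integrableOn (hUvar n)).trans_eq ?_
      simp [mul_comm]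
    have hU1 : ∫ ω in A n, U n ω (Z n ω) ∂μ = 0 :=
      setIntegral_apply_eq_zero_of_condExp_eq_zero (ℱ.le n) (hUint n) (hZad n)
        (hUZ n (hΦint n)) (hUmean n) (hAm n)
    have hi1 : IntegrableOn (fun ω => Φ (Y n ω)) (A n) μ := (hΦint n).integrableOn
    have hi2 : IntegrableOn (fun ω => η * U n ω (Z n ω)) (A n) μ :=
      ((hUZ n (hΦint n)).const_mul η).integrableOn
    have hi3 : IntegrableOn (fun ω => η ^ 2 / K * ‖U n ω‖ ^ 2) (A n) μ :=
      ((hU2int n).const_mul _).integrableOn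
    have hi4 : IntegrableOn (fun _ : Ω => η ^ 2 / K * L ^ 2 - η * γ * r ^ 2) (A n) μ :=
      (integrable_const _).integrableOn
    have hi12 : IntegrableOn (fun ω => Φ (Y n ω) + η * U n ω (Z n ω)) (A n) μ := hi1.add hi2
    have hi123 : IntegrableOn
        (fun ω => Φ (Y n ω) + η * U n ω (Z n ω) + η ^ 2 / K * ‖U n ω‖ ^ 2) (A n) μ :=
      hi12.add hi3
    calc ∫ ω in A n, Φ (Y (n + 1) ω) ∂μ
        ≤ ∫ ω in A n, (Φ (Y n ω) + η * U n ω (Z n ω) + η ^ 2 / K * ‖U n ω‖ ^ 2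
            + (η ^ 2 / K * L ^ 2 - η * γ * r ^ 2)) ∂μ := by
          refine setIntegral_mono_on (hΦint (n + 1)).integrableOn
            (hi123.add hi4) hA fun ω hω => ?_
          have h1 : r ^ 2 ≤ ‖Z n ω‖ ^ 2 :=
            pow_le_pow_left₀ hr0.le (not_le.1 (hω n le_rfl)).le 2
          have h2 := mul_le_mul_of_nonneg_left h1 (mul_pos hη hγ).le
          linarith [hstep n ω]
      _ = ∫ ω in A n, Φ (Y n ω) ∂μ + η ^ 2 / K * ∫ ω in A n, ‖U n ω‖ ^ 2 ∂μ
            + (η ^ 2 / K * L ^ 2 - η * γ * r ^ 2) * μ.real (A n) := by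
          rw [integral_add hi123 hi4, integral_add hi12 hi3,
            integral_add hi1 hi2, integral_const_mul, integral_const_mul, hU1,
            setIntegral_const]
          simp only [smul_eq_mul]
          ring
      _ ≤ ∫ ω in A n, Φ (Y n ω) ∂μ + η ^ 2 / K * (σ ^ 2 * μ.real (A n))
            + (η ^ 2 / K * L ^ 2 - η * γ * r ^ 2) * μ.real (A n) := by
          gcongr
      _ = _ := by
          rw [hρ]
          field_simp
          ring
  calc ∫⁻ ω, (⨅ (n : ℕ) (_ : ‖Q (Y n ω) - xstar‖ ≤ r), (n : ℝ≥0∞)) ∂μ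
      ≤ ∫⁻ ω, ∑' n, (A n).indicator (fun _ => (1 : ℝ≥0∞)) ω ∂μ :=
        lintegral_mono fun ω =>
          iInf_cast_le_tsum_indicator (fun n ω => ‖Q (Y n ω) - xstar‖ ≤ r) ω
    _ = ∑' n, μ (A n) := by
        rw [lintegral_tsum fun n =>
          (measurable_const.indicator (ℱ.le n _ (hAm n))).aemeasurable]
        exact tsum_congr fun n => by
          rw [lintegral_indicator_const (ℱ.le n _ (hAm n)), one_mul]
    _ ≤ ENNReal.ofReal ((∫ ω, Φ (Y 0 ω) ∂μ) / (γ * η * (r ^ 2 - ρ))) :=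
        tsum_measure_le_of_drift hc hΦ0 hΦint hAanti hdrift
    _ = _ := by simp [hY0, Φ, hstar_eq]
end

section
/- Time-averaged mean squared distance bound for FTRL in strongly monotone games: under the FTRL iteration Y_{n+1} = Y_n + η ĝ_n, X_n = Q(Y_n) with constant step-size η > 0, ĝ_n = V(X_n) + U_n with E[U_n | F_n] = 0 and E[‖U_n‖*² | F_n] ≤ σ², in a γ-strongly monotone game with equilibrium x* satisfying ⟨V(x*), x − x*⟩ ≤ 0 for all x, with ‖V(x)‖* ≤ L and h K-strongly convex, and with r_σ² = η(σ² + L²)/(γK), one has for every n ≥ 1: (1/n) · E[ Σ_{k=0}^{n−1} ‖X_k − x*‖² ] ≤ F(x*, Y_0)/(γ η n) + r_σ². -/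
open MeasureTheory Filter
open scoped ENNReal

section MirrorMap

variable {E : Type*} [NormedAddCommGroup E] [NormedSpace ℝ E] {X : Set E} {h : E → ℝ} {K : ℝ}
  {Q : (E →L[ℝ] ℝ) → E}

/-- A maximizer of a strongly concave function satisfies a quadratic growth bound. -/
lemma quadratic_growth_of_strongly_convex (hXcv : Convex ℝ X) (hK : 0 < K)
    (hsc : ∀ x ∈ X, ∀ x' ∈ X, ∀ t : ℝ, t ∈ Set.Icc (0:ℝ) 1 →
      h (t • x + (1 - t) • x') ≤
        t * h x + (1 - t) * h x' - K / 2 * (t * (1 - t)) * ‖x' - x‖ ^ 2)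
    (y : E →L[ℝ] ℝ) {q : E} (hq : q ∈ X) (hmax : ∀ x ∈ X, y x - h x ≤ y q - h q)
    {x : E} (hx : x ∈ X) :
    y x - h x + K / 2 * ‖x - q‖ ^ 2 ≤ y q - h q := by
  refine le_of_forall_pos_le_add fun ε hε => ?_
  set c : ℝ := K / 2 * ‖x - q‖ ^ 2 with hc
  have hc0 : 0 ≤ c := by positivity
  obtain ⟨t, ht0, ht1, htc⟩ : ∃ t : ℝ, 0 < t ∧ t ≤ 1 ∧ c * t ≤ ε := by
    refine ⟨min 1 (ε / (c + 1)), by positivity, min_le_left _ _, ?_⟩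
    calc c * min 1 (ε / (c + 1)) ≤ (c + 1) * (ε / (c + 1)) := by
          gcongr
          · linarith
          · exact min_le_right _ _
      _ = ε := by field_simp
  have hconv := hsc x hx q hq t ⟨ht0.le, ht1⟩
  have hopt := hmax _ (hXcv hx hq ht0.le (sub_nonneg.2 ht1) (by ring))
  rw [map_add, map_smul, map_smul, smul_eq_mul, smul_eq_mul] at hopt
  rw [norm_sub_rev q x] at hconv
  have hmul : t * (y x - h x + c * (1 - t)) ≤ t * (y q - h q) := by
    rw [hc]
    linarith
  have := le_of_mul_le_mul_left hmul ht0
  linarith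

/-- Young's inequality with weight `K`. -/
lemma mul_le_add_sq_div (hK : 0 < K) (a b : ℝ) :
    a * b ≤ K / 2 * b ^ 2 + a ^ 2 / (2 * K) := by
  have : K / 2 * b ^ 2 + a ^ 2 / (2 * K) - a * b = (a - K * b) ^ 2 / (2 * K) := by
    field_simp
    ring
  have : 0 ≤ (a - K * b) ^ 2 / (2 * K) := by positivity
  linarith

/-- The mirror map of a `K`-strongly convex regularizer is `K⁻¹`-Lipschitz. -/
lemma norm_mirror_sub_le (hK : 0 < K) (hQmem : ∀ y, Q y ∈ X)
    (hgrow : ∀ y, ∀ x ∈ X, y x - h x + K / 2 * ‖x - Q y‖ ^ 2 ≤ y (Q y) - h (Q y))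
    (y y' : E →L[ℝ] ℝ) : ‖Q y - Q y'‖ ≤ K⁻¹ * ‖y - y'‖ := by
  have h1 := hgrow y _ (hQmem y')
  have h2 := hgrow y' _ (hQmem y)
  have h3 : (y - y') (Q y - Q y') ≤ ‖y - y'‖ * ‖Q y - Q y'‖ :=
    (le_abs_self _).trans ((y - y').le_opNorm _)
  simp only [sub_apply, map_sub] at h3
  rw [norm_sub_rev (Q y')] at h1
  rw [inv_mul_eq_div, le_div_iff₀ hK]
  rcases (norm_nonneg (Q y - Q y')).eq_or_lt with h0 | h0
  · rw [← h0, zero_mul]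
    positivity
  · refine le_of_mul_le_mul_right ?_ h0
    linarith

/-- Smoothness of the conjugate of a `K`-strongly convex regularizer. -/
lemma conjugate_le_add (hK : 0 < K) (hQmem : ∀ y, Q y ∈ X)
    (hgrow : ∀ y, ∀ x ∈ X, y x - h x + K / 2 * ‖x - Q y‖ ^ 2 ≤ y (Q y) - h (Q y))
    (y w : E →L[ℝ] ℝ) :
    (y + w) (Q (y + w)) - h (Q (y + w)) ≤
      y (Q y) - h (Q y) + w (Q y) + ‖w‖ ^ 2 / (2 * K) := by
  have h1 := hgrow y _ (hQmem (y + w))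
  have h3 : w (Q (y + w) - Q y) ≤ ‖w‖ * ‖Q (y + w) - Q y‖ :=
    (le_abs_self _).trans (w.le_opNorm _)
  have h4 := mul_le_add_sq_div hK ‖w‖ ‖Q (y + w) - Q y‖
  rw [map_sub] at h3
  rw [add_apply]
  linarith

/-- One step of mirror descent decreases the Fenchel coupling to `p`, up to noise and a
second-order term, whenever the drift `v` points towards `p`. -/
lemma fenchel_coupling_descent (hK : 0 < K) (hQmem : ∀ y, Q y ∈ X)
    (hgrow : ∀ y, ∀ x ∈ X, y x - h x + K / 2 * ‖x - Q y‖ ^ 2 ≤ y (Q y) - h (Q y))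
    {η γ L : ℝ} (hη : 0 ≤ η) {y v : E →L[ℝ] ℝ} {p : E} (hv : ‖v‖ ≤ L)
    (hdrift : v (Q y - p) ≤ -γ * ‖Q y - p‖ ^ 2) (u : E →L[ℝ] ℝ) :
    γ * η * ‖Q y - p‖ ^ 2 ≤
      (y (Q y) - h (Q y) - y p) - ((y + η • (v + u)) (Q (y + η • (v + u)))
          - h (Q (y + η • (v + u))) - (y + η • (v + u)) p)
        + (η * u (Q y - p) + η ^ 2 / K * (L ^ 2 + ‖u‖ ^ 2)) := by
  have hsmooth := conjugate_le_add hK hQmem hgrow y (η • (v + u))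
  have hnorm : ‖η • (v + u)‖ ^ 2 / (2 * K) ≤ η ^ 2 / K * (L ^ 2 + ‖u‖ ^ 2) := by
    have hle : ‖v + u‖ ≤ L + ‖u‖ := (norm_add_le _ _).trans (by gcongr)
    have hsq : ‖v + u‖ ^ 2 ≤ 2 * (L ^ 2 + ‖u‖ ^ 2) :=
      (pow_le_pow_left₀ (norm_nonneg _) hle 2).trans (by nlinarith [sq_nonneg (L - ‖u‖)])
    rw [norm_smul, mul_pow, Real.norm_eq_abs, sq_abs]
    calc η ^ 2 * ‖v + u‖ ^ 2 / (2 * K)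
        ≤ η ^ 2 * (2 * (L ^ 2 + ‖u‖ ^ 2)) / (2 * K) := by gcongr
      _ = η ^ 2 / K * (L ^ 2 + ‖u‖ ^ 2) := by field_simp
  have hdrift' := mul_le_mul_of_nonneg_left hdrift hη
  simp only [add_apply, smul_apply, smul_eq_mul, map_sub] at hsmooth hdrift' ⊢
  linarith

end MirrorMap

section Noise

variable {E : Type*} [NormedAddCommGroup E] [NormedSpace ℝ E]
  {Ω : Type*} {m mΩ : MeasurableSpace Ω} {μ : Measure Ω}

lemma memLp_add_const_smul_add {F : Type*} [NormedAddCommGroup F] [NormedSpace ℝ F]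
    {p : ℝ≥0∞} {f g u : Ω → F} (hf : MemLp f p μ) (hg : MemLp g p μ) (hu : MemLp u p μ)
    (η : ℝ) : MemLp (fun ω => f ω + η • (g ω + u ω)) p μ :=
  hf.add ((hg.add hu).const_smul η)

lemma integrable_dual_apply_of_memLp_two {U : Ω → E →L[ℝ] ℝ} {Z : Ω → E}
    (hU : MemLp U 2 μ) (hZ : MemLp Z 2 μ) : Integrable (fun ω => U ω (Z ω)) μ :=
  memLp_one_iff_integrable.1
    ((ContinuousLinearMap.apply ℝ ℝ : E →L[ℝ] (E →L[ℝ] ℝ) →L[ℝ] ℝ).memLp_of_bilin 1 hZ hU)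

/-- Conditionally centered noise is uncorrelated with the past. -/
lemma integral_dual_apply_eq_zero_of_condExp_eq_zero [IsFiniteMeasure μ] (hm : m ≤ mΩ)
    {U : Ω → E →L[ℝ] ℝ} {Z : Ω → E} (hU : MemLp U 2 μ) (hZ : MemLp Z 2 μ) (hZm : StronglyMeasurable[m] Z)
    (hU0 : μ[U | m] =ᵐ[μ] 0) : ∫ ω, U ω (Z ω) ∂μ = 0 := by
  have hUZ : Integrable (fun ω => U ω (Z ω)) μ := integrable_dual_apply_of_memLp_two hU hZ
  have hpull := condExp_bilin_of_stronglyMeasurable_left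
    (ContinuousLinearMap.apply ℝ ℝ : E →L[ℝ] (E →L[ℝ] ℝ) →L[ℝ] ℝ) hZm hUZ
    (hU.integrable (by norm_num))
  rw [← integral_condExp hm]
  refine integral_eq_zero_of_ae ?_
  filter_upwards [hpull, hU0] with ω h1 h2
  simpa [h2] using h1

lemma integral_le_of_condExp_le [IsProbabilityMeasure μ] (hm : m ≤ mΩ) {f : Ω → ℝ} {c : ℝ}
    (hf : μ[f | m] ≤ᵐ[μ] fun _ => c) : ∫ ω, f ω ∂μ ≤ c := by
  rw [← integral_condExp hm]
  simpa using integral_mono_ae integrable_condExp (integrable_const c) hf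

end Noise

/-- **time-averaged mean squared distance bound for FTRL in
strongly monotone games.**
Under the FTRL iteration `Y (n+1) = Y n + η ĝ n`, `X n = Q (Y n)` with constant
step-size `η > 0`, `ĝ n = V (X n) + U n` with `E[U n | ℱ n] = 0` and
`E[‖U n‖*² | ℱ n] ≤ σ²`, in a `γ`-strongly monotone game with equilibrium `x*`
satisfying `⟨V x*, x - x*⟩ ≤ 0` on `X`, with `‖V x‖* ≤ L` and `h` `K`-strongly
convex, and with `r_σ² = η (σ² + L²) / (γ K)`, one has for every `n ≥ 1`:
`(1/n) E[Σ_{k < n} ‖X k - x*‖²] ≤ F (x*, Y 0) / (γ η n) + r_σ²`. -/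
theorem ftrl_time_averaged_distance_strongly_monotone
    {E : Type*} [NormedAddCommGroup E] [NormedSpace ℝ E] [FiniteDimensional ℝ E]
    (X : Set E) (hXne : X.Nonempty) (hXcl : IsClosed X) (hXcv : Convex ℝ X)
    -- the regularizer and its mirror map / conjugate / Fenchel coupling
    (h : E → ℝ) (K : ℝ) (hK : 0 < K)
    (hcont : ContinuousOn h X)
    (hsc : ∀ x ∈ X, ∀ x' ∈ X, ∀ t : ℝ, t ∈ Set.Icc (0:ℝ) 1 →
      h (t • x + (1 - t) • x') ≤
        t * h x + (1 - t) * h x' - K / 2 * (t * (1 - t)) * ‖x' - x‖ ^ 2)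
    (Q : (E →L[ℝ] ℝ) → E)
    (hQmem : ∀ y, Q y ∈ X)
    (hQmax : ∀ y, ∀ x ∈ X, y x - h x ≤ y (Q y) - h (Q y))
    (hstar : (E →L[ℝ] ℝ) → ℝ)
    (hstar_eq : ∀ y, hstar y = y (Q y) - h (Q y))
    -- the strongly monotone game and its equilibrium
    (V : E → (E →L[ℝ] ℝ)) (hVcont : Continuous V)
    (γ : ℝ) (hγ : 0 < γ)
    (hmono : ∀ x ∈ X, ∀ x' ∈ X, (V x' - V x) (x' - x) ≤ -γ * ‖x' - x‖ ^ 2)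
    (L : ℝ) (hL : ∀ x ∈ X, ‖V x‖ ≤ L)
    (xstar : E) (hxstar : xstar ∈ X)
    (heq : ∀ x ∈ X, (V xstar) (x - xstar) ≤ 0)
    -- the stochastic process
    {Ω : Type*} {mΩ : MeasurableSpace Ω} {μ : Measure Ω} [IsProbabilityMeasure μ]
    (ℱ : Filtration ℕ mΩ)
    (η : ℝ) (hη : 0 < η)
    (y₀ : E →L[ℝ] ℝ)
    (Y U : ℕ → Ω → (E →L[ℝ] ℝ))
    (hY0 : ∀ ω, Y 0 ω = y₀)
    (hrec : ∀ n ω, Y (n + 1) ω = Y n ω + η • (V (Q (Y n ω)) + U n ω))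
    (hYad : ∀ n, StronglyMeasurable[ℱ n] (Y n))
    (hUad : ∀ n, StronglyMeasurable[ℱ (n + 1)] (U n))
    (hUint : ∀ n, Integrable (U n) μ)
    (hU2int : ∀ n, Integrable (fun ω => ‖U n ω‖ ^ 2) μ)
    (hUmean : ∀ n, μ[U n | ℱ n] =ᵐ[μ] 0)
    (σ : ℝ)
    (hUvar : ∀ n, μ[fun ω => ‖U n ω‖ ^ 2 | ℱ n] ≤ᵐ[μ] fun _ : Ω => σ ^ 2)
    (n : ℕ) (hn : 1 ≤ n) :
    (∫⁻ ω, ∑ k ∈ Finset.range n, ENNReal.ofReal (‖Q (Y k ω) - xstar‖ ^ 2) ∂μ)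
        / (n : ℝ≥0∞) ≤
      ENNReal.ofReal ((h xstar + hstar y₀ - y₀ xstar) / (γ * η * n)
        + η * (σ ^ 2 + L ^ 2) / (γ * K)) := by
  have hgrow : ∀ y, ∀ x ∈ X, y x - h x + K / 2 * ‖x - Q y‖ ^ 2 ≤ y (Q y) - h (Q y) :=
    fun y x hx => quadratic_growth_of_strongly_convex hXcv hK hsc y (hQmem y) (hQmax y) hx
  have hQcont : Continuous Q :=
    (LipschitzWith.of_dist_le' (K := K⁻¹) fun y y' => by
      simpa only [dist_eq_norm] using norm_mirror_sub_le hK hQmem hgrow y y').continuous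
  have hUmem : ∀ k, MemLp (U k) 2 μ := fun k =>
    (memLp_two_iff_integrable_sq_norm (hUint k).aestronglyMeasurable).2 (hU2int k)
  have hYm : ∀ k, AEStronglyMeasurable (Y k) μ := fun k =>
    ((hYad k).mono (ℱ.le k)).aestronglyMeasurable
  have hYmem : ∀ k, MemLp (Y k) 2 μ := by
    intro k
    induction k with
    | zero =>
      rw [show Y 0 = fun _ => y₀ from funext hY0]
      exact memLp_const y₀
    | succ k ih =>
      have hVmem : MemLp (fun ω => V (Q (Y k ω))) 2 μ :=
        MemLp.of_bound ((hVcont.comp hQcont).comp_aestronglyMeasurable (hYm k)) L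
          (ae_of_all _ fun ω => hL _ (hQmem _))
      rw [funext (hrec k)]
      exact memLp_add_const_smul_add ih hVmem (hUmem k) η
  have hZad : ∀ k, StronglyMeasurable[ℱ k] (fun ω => Q (Y k ω) - xstar) := fun k =>
    (hQcont.comp_stronglyMeasurable (hYad k)).sub stronglyMeasurable_const
  have hZmem : ∀ k, MemLp (fun ω => Q (Y k ω) - xstar) 2 μ := by
    intro k
    have hdiff : MemLp (fun ω => Q (Y k ω) - Q 0) 2 μ := by
      refine (hYmem k).of_le_mul (c := K⁻¹)
        ((hQcont.comp_aestronglyMeasurable (hYm k)).sub aestronglyMeasurable_const)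
        (ae_of_all _ fun ω => ?_)
      simpa using norm_mirror_sub_le hK hQmem hgrow (Y k ω) 0
    convert hdiff.add (memLp_const (Q 0 - xstar)) using 2 with ω
    simp
  have hZ2 : ∀ k, Integrable (fun ω => ‖Q (Y k ω) - xstar‖ ^ 2) μ := fun k =>
    (hZmem k).integrable_norm_pow two_ne_zero
  have hstep : ∀ k ω,
      γ * η * ‖Q (Y k ω) - xstar‖ ^ 2 ≤
        (hstar (Y k ω) - Y k ω xstar) - (hstar (Y (k + 1) ω) - Y (k + 1) ω xstar)
          + (η * U k ω (Q (Y k ω) - xstar) + η ^ 2 / K * (L ^ 2 + ‖U k ω‖ ^ 2)) := by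
    intro k ω
    have h1 := hmono xstar hxstar _ (hQmem (Y k ω))
    have h2 := heq _ (hQmem (Y k ω))
    rw [sub_apply] at h1
    rw [hrec k ω, hstar_eq, hstar_eq]
    exact fenchel_coupling_descent hK hQmem hgrow hη.le (hL _ (hQmem _)) (by linarith) _
  have hsum : ∀ ω, γ * η * ∑ k ∈ Finset.range n, ‖Q (Y k ω) - xstar‖ ^ 2 ≤
      (h xstar + hstar y₀ - y₀ xstar) + ∑ k ∈ Finset.range n,
        (η * U k ω (Q (Y k ω) - xstar) + η ^ 2 / K * (L ^ 2 + ‖U k ω‖ ^ 2)) := by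
    intro ω
    have hs := Finset.sum_le_sum fun k (_ : k ∈ Finset.range n) => hstep k ω
    rw [← Finset.mul_sum, Finset.sum_add_distrib,
      Finset.sum_range_sub' (fun k => hstar (Y k ω) - Y k ω xstar), hY0] at hs
    have hn := hQmax (Y n ω) xstar hxstar
    rw [← hstar_eq] at hn
    linarith
  have hUZ : ∀ k, Integrable (fun ω => U k ω (Q (Y k ω) - xstar)) μ := fun k =>
    integrable_dual_apply_of_memLp_two (hUmem k) (hZmem k)
  have hA : ∀ k, Integrable (fun ω => η * U k ω (Q (Y k ω) - xstar)) μ := fun k =>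
    (hUZ k).const_mul η
  have hB : ∀ k, Integrable (fun ω => η ^ 2 / K * (L ^ 2 + ‖U k ω‖ ^ 2)) μ := fun k =>
    ((integrable_const _).add (hU2int k)).const_mul _
  have hAB : ∀ k, Integrable (fun ω => η * U k ω (Q (Y k ω) - xstar)
      + η ^ 2 / K * (L ^ 2 + ‖U k ω‖ ^ 2)) μ := fun k => (hA k).add (hB k)
  have herr : ∀ k, ∫ ω, (η * U k ω (Q (Y k ω) - xstar)
      + η ^ 2 / K * (L ^ 2 + ‖U k ω‖ ^ 2)) ∂μ ≤ η ^ 2 / K * (L ^ 2 + σ ^ 2) := by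
    intro k
    rw [integral_add (hA k) (hB k), integral_const_mul, integral_const_mul,
      integral_dual_apply_eq_zero_of_condExp_eq_zero (ℱ.le k) (hUmem k) (hZmem k) (hZad k)
        (hUmean k), integral_add (integrable_const _) (hU2int k), integral_const,
      probReal_univ, one_smul, mul_zero, zero_add]
    gcongr
    exact integral_le_of_condExp_le (ℱ.le k) (hUvar k)
  have hS : Integrable (fun ω => ∑ k ∈ Finset.range n, ‖Q (Y k ω) - xstar‖ ^ 2) μ :=
    integrable_finsetSum _ fun k _ => hZ2 k
  have hmain : γ * η * ∫ ω, ∑ k ∈ Finset.range n, ‖Q (Y k ω) - xstar‖ ^ 2 ∂μ ≤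
      (h xstar + hstar y₀ - y₀ xstar) + n * (η ^ 2 / K * (L ^ 2 + σ ^ 2)) := by
    have hR : Integrable (fun ω => ∑ k ∈ Finset.range n,
        (η * U k ω (Q (Y k ω) - xstar) + η ^ 2 / K * (L ^ 2 + ‖U k ω‖ ^ 2))) μ :=
      integrable_finsetSum _ fun k _ => hAB k
    have hint := integral_mono (hS.const_mul (γ * η)) ((integrable_const _).add hR) hsum
    rw [integral_const_mul] at hint
    refine hint.trans ?_
    simp only [Pi.add_apply]
    rw [integral_add (integrable_const _) hR, integral_const, probReal_univ, one_smul,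
      integral_finsetSum _ fun k _ => hAB k]
    gcongr
    simpa using Finset.sum_le_sum fun k (_ : k ∈ Finset.range n) => herr k
  have hn0 : (0 : ℝ) < n := by exact_mod_cast hn
  have hlint : ∫⁻ ω, ∑ k ∈ Finset.range n, ENNReal.ofReal (‖Q (Y k ω) - xstar‖ ^ 2) ∂μ =
      ENNReal.ofReal (∫ ω, ∑ k ∈ Finset.range n, ‖Q (Y k ω) - xstar‖ ^ 2 ∂μ) := by
    rw [ofReal_integral_eq_lintegral_ofReal hS
      (ae_of_all _ fun ω => Finset.sum_nonneg fun k _ => by positivity)]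
    refine lintegral_congr fun ω => ?_
    rw [ENNReal.ofReal_sum_of_nonneg fun k _ => by positivity]
  rw [hlint, ← ENNReal.ofReal_natCast n, ← ENNReal.ofReal_div_of_pos hn0]
  refine ENNReal.ofReal_le_ofReal ?_
  rw [div_le_iff₀ hn0]
  refine le_of_mul_le_mul_left (hmain.trans_eq ?_) (mul_pos hγ hη)
  field_simp
  ring
end

section
/- Positivity of the marginal density on compacts: let X be a metric space and let p: X × ℝ^{d₁} × ℝ^{d₂} → [0,∞) be jointly continuous, and define the marginal p̃(x, w) = ∫_{ℝ^{d₂}} p(x, w, u) du (Lebesgue integral over ℝ^{d₂}). If for every compact set C ⊆ X and every (w, u) ∈ ℝ^{d₁} × ℝ^{d₂} one has inf_{x∈C} p(x, w, u) > 0, then for every compact set C ⊆ X and every w ∈ ℝ^{d₁}: inf_{x∈C} p̃(x, w) > 0. -/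
open MeasureTheory
open scoped ENNReal

/-- **positivity of the marginal density on compacts.**
Let `X` be a metric space and let `p : X × ℝ^{d₁} × ℝ^{d₂} → [0, ∞)` be jointly
continuous, and define the marginal `p̃ (x, w) = ∫_{ℝ^{d₂}} p (x, w, u) du`
(Lebesgue integral over `ℝ^{d₂}`, possibly `+∞`).  If for every compact set
`C ⊆ X` and every `(w, u)` one has `inf_{x ∈ C} p (x, w, u) > 0`, then for
every compact set `C ⊆ X` and every `w`: `inf_{x ∈ C} p̃ (x, w) > 0`.
(Infima are taken in `ℝ≥0∞`, so that the infimum over an empty compact set is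
`∞ > 0`, matching the usual convention.) -/
theorem marginal_density_pos_on_compacts
    {X : Type*} [MetricSpace X]
    (d₁ d₂ : ℕ) (hd₁ : 1 ≤ d₁) (hd₂ : 1 ≤ d₂)
    (p : X → (Fin d₁ → ℝ) → (Fin d₂ → ℝ) → ℝ)
    (hp_nonneg : ∀ x w u, 0 ≤ p x w u)
    (hp_cont : Continuous (fun q : X × (Fin d₁ → ℝ) × (Fin d₂ → ℝ) => p q.1 q.2.1 q.2.2))
    (hpos : ∀ C : Set X, IsCompact C → ∀ w u,
      0 < ⨅ x ∈ C, ENNReal.ofReal (p x w u)) :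
    ∀ C : Set X, IsCompact C → ∀ w,
      0 < ⨅ x ∈ C, ∫⁻ u, ENNReal.ofReal (p x w u) := by
  intro C hC w
  have hcont (x : X) : Continuous fun u => ENNReal.ofReal (p x w u) :=
    ENNReal.continuous_ofReal.comp (hp_cont.comp (f := fun u => (x, w, u)) (by fun_prop))
  have hmeas : Measurable fun u => ⨅ x ∈ C, ENNReal.ofReal (p x w u) :=
    (upperSemicontinuous_biInf fun x _ => (hcont x).upperSemicontinuous).measurable
  have hint : 0 < ∫⁻ u, ⨅ x ∈ C, ENNReal.ofReal (p x w u) := by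
    rw [lintegral_pos_iff_support hmeas,
      Function.support_eq_univ fun u => (hpos C hC w u).ne']
    exact isOpen_univ.measure_pos _ Set.univ_nonempty
  exact hint.trans_le <| le_iInf₂ fun x hx =>
    lintegral_mono fun u => iInf₂_le x hx
end
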